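/- arXiv:2412.20849 — 2 statements merged into one kernel-verified Lean document; each statement's English description precedes it below -/
import Mathlib

section
/- Let $\gamma_i = i!$ for $0 \le i \le 9$ and let $f(x) = (x - \tfrac{1}{3})(x - 11)$. Define $\varphi_0,\ldots,\varphi_5$ as the coefficients of $h(x) = f(x)g(x) = x^6 - \sum_{i=0}^{5}\varphi_i x^i$, where $g(x) = x^4 - \frac{1695024}{137503}x^3 + \frac{11282760}{137503}x^2 - \frac{41197920}{137503}x + \frac{46998216}{137503}$, and set $\gamma_{10} = \sum_{i=1}^{6}\varphi_{6-i}\gamma_{10-i} = \frac{492324551232}{137503}$. Then the $6\times 6$ Hankel matrix $M_5 = (\gamma_{i+j-2})_{i,j=1}^6$ is NOT positive semidefinite; consequently there is no $6$-atomic representing measure for $(\gamma_0,\ldots,\gamma_9)$ containing the atoms $\tfrac13$ and $11$. -/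
/-- The monic Laguerre polynomial of degree five, evaluated as a quadratic form of the moment
matrix, shows that a tenth moment below `10! - 5!²` destroys positivity. -/
lemma not_posSemidef_of_factorial_moments (γ : ℕ → ℝ)
    (hγ : ∀ i ≤ 9, γ i = (Nat.factorial i : ℝ))
    (hγ10 : γ 10 < (Nat.factorial 10 : ℝ) - (Nat.factorial 5 : ℝ) ^ 2)
    (M : Matrix (Fin 6) (Fin 6) ℝ)
    (hM : ∀ i j : Fin 6, M i j = γ ((i : ℕ) + (j : ℕ))) :
    ¬ M.PosSemidef := by
  intro h
  have hv := h.dotProduct_mulVec_nonneg ![-120, 600, -600, 200, -25, 1]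
  simp [dotProduct, Matrix.mulVec, Fin.sum_univ_succ, hM, hγ, Nat.factorial] at hv hγ10
  linarith

/-- The moments of a measure supported on six atoms, localized at `(X - y 0) (X - y 1)`, satisfy
the linear recurrence with characteristic polynomial
`(X - y 2) (X - y 3) (X - y 4) (X - y 5)`. -/
lemma localized_moments_recurrence (γ : ℕ → ℝ) (ρ y : Fin 6 → ℝ) (i : ℕ)
    (hγ : ∀ k ≤ i + 6, γ k = ∑ j, ρ j * y j ^ k) (p : ℕ → ℝ)
    (hp : p = fun k => γ (k + 2) - (y 0 + y 1) * γ (k + 1) + y 0 * y 1 * γ k) :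
    p (i + 4) - (y 2 + y 3 + y 4 + y 5) * p (i + 3)
      + (y 2 * y 3 + y 2 * y 4 + y 2 * y 5 + y 3 * y 4 + y 3 * y 5 + y 4 * y 5) * p (i + 2)
      - (y 2 * y 3 * y 4 + y 2 * y 3 * y 5 + y 2 * y 4 * y 5 + y 3 * y 4 * y 5) * p (i + 1)
      + y 2 * y 3 * y 4 * y 5 * p i = 0 := by
  subst hp
  simp only [add_assoc, Nat.reduceAdd]
  rw [hγ i (by omega), hγ (i + 1) (by omega), hγ (i + 2) (by omega), hγ (i + 3) (by omega),
    hγ (i + 4) (by omega), hγ (i + 5) (by omega), hγ (i + 6) (by omega)]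
  simp only [Fin.sum_univ_six, pow_add]
  ring

/-- Example 3.6: with `γ_i = i!` for `i ≤ 9` and the forced candidate
`γ_10 = 492324551232/137503`, the extended Hankel matrix `M_5` is not
positive semidefinite; consequently there is no 6-atomic representing
measure for `(γ_0,…,γ_9)` containing the atoms `1/3` and `11`. -/
theorem stmt_18 (γ : ℕ → ℝ)
    (hγ : ∀ i ≤ 9, γ i = (Nat.factorial i : ℝ))
    (hγ10 : γ 10 = 492324551232 / 137503)
    (M : Matrix (Fin 6) (Fin 6) ℝ)
    (hM : ∀ i j : Fin 6, M i j = γ ((i : ℕ) + (j : ℕ))) :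
    ¬ M.PosSemidef ∧
    ¬ ∃ (ρ y : Fin 6 → ℝ), (∀ j, 0 < ρ j) ∧ Function.Injective y ∧
        y 0 = 1 / 3 ∧ y 1 = 11 ∧
        ∀ i ≤ 9, γ i = ∑ j, ρ j * y j ^ i := by
  refine ⟨not_posSemidef_of_factorial_moments γ hγ
    (by rw [hγ10]; norm_num [Nat.factorial]) M hM, ?_⟩
  rintro ⟨ρ, y, -, -, hy0, hy1, hmom⟩
  have key (i : ℕ) (hi : i ≤ 3) := localized_moments_recurrence γ ρ y i
    (fun k hk => hmom k (by omega)) _ rfl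
  have eq0 := key 0 (by norm_num)
  have eq1 := key 1 (by norm_num)
  have eq2 := key 2 (by norm_num)
  have eq3 := key 3 (by norm_num)
  simp only [hy0, hy1, Nat.reduceAdd, hγ 0 (by norm_num), hγ 1 (by norm_num),
    hγ 2 (by norm_num), hγ 3 (by norm_num), hγ 4 (by norm_num), hγ 5 (by norm_num),
    hγ 6 (by norm_num), hγ 7 (by norm_num), hγ 8 (by norm_num), hγ 9 (by norm_num),
    Nat.factorial] at eq0 eq1 eq2 eq3
  norm_num at eq0 eq1 eq2 eq3
  -- The four linear equations determine the first two elementary symmetric functions of the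
  -- remaining atoms, and these force the sum of the squares of the atoms to be negative.
  have he1 : y 2 + y 3 + y 4 + y 5 = 1695024 / 137503 := by linarith
  have he2 : y 2 * y 3 + y 2 * y 4 + y 2 * y 5 + y 3 * y 4 + y 3 * y 5 + y 4 * y 5
      = 11282760 / 137503 := by linarith
  have hsq : y 2 ^ 2 + y 3 ^ 2 + y 4 ^ 2 + y 5 ^ 2
      = (1695024 / 137503) ^ 2 - 2 * (11282760 / 137503) := by
    rw [← he1, ← he2]; ring
  have hnonneg : 0 ≤ y 2 ^ 2 + y 3 ^ 2 + y 4 ^ 2 + y 5 ^ 2 := by positivity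
  rw [hsq] at hnonneg
  norm_num at hnonneg
end

section
/- Let $\gamma_i = i!$ for $0 \le i \le 9$, and define $\gamma_{10} = \frac{5944515264}{1601}$. Then the $6 \times 6$ Hankel matrix $M_5 = (\gamma_{i+j-2})_{i,j=1}^{6}$ is positive definite, and the sequence $(\gamma_0,\ldots,\gamma_9)$ admits a $6$-atomic representing measure containing the atoms $1$ and $11$, with the remaining four atoms being the roots of $g(x) = x^4 - \frac{95824}{1601}x^3 + \frac{753912}{1601}x^2 - \frac{1476768}{1601}x + \frac{220344}{1601}$. -/
/-- If the atoms `y j` satisfy the same linear recursion as `γ` and the Hankel matrix of `γ` is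
positive definite, then `γ` is represented by positive weights at the atoms. -/
theorem exists_pos_weights_of_recursion {n : ℕ} {γ : ℕ → ℝ} {y c : Fin n → ℝ}
    (hy : Function.Injective y) (hyc : ∀ j, y j ^ n = ∑ k, c k * y j ^ (k : ℕ))
    (hγc : ∀ m, m + n ≤ 2 * n - 2 → γ (m + n) = ∑ k, c k * γ (m + k))
    (hpos : (Matrix.of fun i j : Fin n => γ ((i : ℕ) + j)).PosDef) :
    ∃ ρ : Fin n → ℝ, (∀ j, 0 < ρ j) ∧ ∀ i ≤ 2 * n - 2, γ i = ∑ j, ρ j * y j ^ i := by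
  set V := Matrix.vandermonde y with hV
  have hdet : IsUnit V.det := (Matrix.det_vandermonde_ne_zero_iff.2 hy).isUnit
  have hunit : IsUnit V := (Matrix.isUnit_iff_isUnit_det V).2 hdet
  set ρ := Matrix.vecMul (fun i : Fin n => γ i) V⁻¹ with hρ
  have hlow : ∀ i : Fin n, γ i = ∑ j, ρ j * y j ^ (i : ℕ) := by
    intro i
    have h : Matrix.vecMul ρ V = fun i : Fin n => γ i := by
      rw [hρ, Matrix.vecMul_vecMul, Matrix.nonsing_inv_mul _ hdet, Matrix.vecMul_one]
    simpa [Matrix.vecMul, dotProduct, hV, Matrix.vandermonde_apply] using (congrFun h i).symm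
  have hmom : ∀ i ≤ 2 * n - 2, γ i = ∑ j, ρ j * y j ^ i := by
    intro i
    induction i using Nat.strong_induction_on with
    | _ i ih =>
      intro hi
      rcases lt_or_ge i n with hin | hin
      · exact hlow ⟨i, hin⟩
      · obtain ⟨m, rfl⟩ := Nat.exists_eq_add_of_le' hin
        have hk : ∀ k : Fin n, c k * γ (m + k) = ∑ j, c k * (ρ j * y j ^ (m + (k : ℕ))) := by
          intro k
          rw [ih (m + k) (by omega) (by omega), Finset.mul_sum]
        rw [hγc m hi, Finset.sum_congr rfl fun k _ => hk k, Finset.sum_comm]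
        refine Finset.sum_congr rfl fun j _ => ?_
        rw [pow_add, hyc j, Finset.mul_sum, Finset.mul_sum]
        exact Finset.sum_congr rfl fun k _ => by ring
  refine ⟨ρ, ?_, hmom⟩
  have hfac : (Matrix.of fun i j : Fin n => γ ((i : ℕ) + j)) =
      star V * Matrix.diagonal ρ * V := by
    ext i j
    rw [Matrix.mul_apply, Matrix.of_apply, hmom _ (by omega)]
    refine Finset.sum_congr rfl fun k _ => ?_
    simp [Matrix.mul_diagonal, Matrix.star_apply, hV, Matrix.vandermonde_apply]
    ring
  rw [hfac, Matrix.IsUnit.posDef_star_left_conjugate_iff hunit, Matrix.posDef_diagonal_iff] at hpos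
  exact hpos

/-- The Hankel matrix of `0!, …, 9!, t` is positive definite once `t` exceeds
`10! - (5!)²`, the value at which it becomes singular. -/
theorem posDef_hankel_factorial {γ : ℕ → ℝ} (hγ : ∀ i ≤ 9, γ i = (Nat.factorial i : ℝ))
    (hγ10 : 3614400 < γ 10) :
    (Matrix.of fun i j : Fin 6 => γ ((i : ℕ) + j)).PosDef := by
  let L : Matrix (Fin 6) (Fin 6) ℝ :=
    !![1, 0, 0, 0, 0, 0;
       1, 1, 0, 0, 0, 0;
       2, 4, 1, 0, 0, 0;
       6, 18, 9, 1, 0, 0;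
       24, 96, 72, 16, 1, 0;
       120, 600, 600, 200, 25, 1]
  let d : Fin 6 → ℝ := ![1, 1, 4, 36, 576, γ 10 - 3614400]
  have hL : IsUnit L := by
    rw [Matrix.isUnit_iff_isUnit_det, Matrix.det_of_isLowerTriangular L]
    · simp [L, Fin.prod_univ_succ]
    · intro i j hij
      fin_cases i <;> fin_cases j <;> first | rfl | (exfalso; revert hij; decide)
  have hfac : (Matrix.of fun i j : Fin 6 => γ ((i : ℕ) + j)) =
      L * Matrix.diagonal d * star L := by
    ext i j
    rw [Matrix.mul_apply, Fin.sum_univ_six]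
    simp only [Matrix.mul_diagonal, Matrix.star_apply, Matrix.of_apply, star_trivial]
    fin_cases i <;> fin_cases j <;> simp [L, d, hγ, Nat.factorial] <;> norm_num
  rw [hfac, Matrix.IsUnit.posDef_star_right_conjugate_iff hL, Matrix.posDef_diagonal_iff]
  intro i
  fin_cases i <;> simp [d, hγ10]

/-- A continuous function with values of opposite sign at `a ≤ b` has a root in `(a, b)`. -/
theorem exists_root_mem_Ioo {f : ℝ → ℝ} (hf : Continuous f) {a b : ℝ} (hab : a ≤ b)
    (h : f a * f b < 0) : ∃ x ∈ Set.Ioo a b, f x = 0 := by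
  rcases mul_neg_iff.1 h with ⟨ha, hb⟩ | ⟨ha, hb⟩
  · exact intermediate_value_Ioo' hab hf.continuousOn ⟨hb, ha⟩
  · exact intermediate_value_Ioo hab hf.continuousOn ⟨ha, hb⟩

/-- Example 3.7: with `γ_i = i!` for `i ≤ 9` and `γ_10 = 5944515264/1601`,
the Hankel matrix `M_5` is positive definite and `(γ_0,…,γ_9)` admits a
6-atomic representing measure with atoms `1` and `11`, the remaining four
atoms being the roots of
`g(x) = x⁴ - (95824/1601)x³ + (753912/1601)x² - (1476768/1601)x + 220344/1601`. -/
theorem stmt_19 (γ : ℕ → ℝ)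
    (hγ : ∀ i ≤ 9, γ i = (Nat.factorial i : ℝ))
    (hγ10 : γ 10 = 5944515264 / 1601)
    (M : Matrix (Fin 6) (Fin 6) ℝ)
    (hM : ∀ i j : Fin 6, M i j = γ ((i : ℕ) + (j : ℕ))) :
    M.PosDef ∧
    ∃ (ρ y : Fin 6 → ℝ), (∀ j, 0 < ρ j) ∧ Function.Injective y ∧
      y 0 = 1 ∧ y 1 = 11 ∧
      (∀ i ≤ 9, γ i = ∑ j, ρ j * y j ^ i) ∧
      ∀ j : Fin 6, 2 ≤ (j : ℕ) →
        (y j) ^ 4 - (95824 / 1601) * (y j) ^ 3 + (753912 / 1601) * (y j) ^ 2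
          - (1476768 / 1601) * (y j) + 220344 / 1601 = 0 := by
  have hMγ : M = Matrix.of fun i j : Fin 6 => γ ((i : ℕ) + j) := Matrix.ext hM
  have hpos := posDef_hankel_factorial hγ (by rw [hγ10]; norm_num)
  refine ⟨hMγ ▸ hpos, ?_⟩
  let g : ℝ → ℝ := fun x => x ^ 4 - (95824 / 1601) * x ^ 3 + (753912 / 1601) * x ^ 2
    - (1476768 / 1601) * x + 220344 / 1601
  have hg : Continuous g := by fun_prop
  obtain ⟨a, ⟨ha0, ha1⟩, ha⟩ := exists_root_mem_Ioo hg (a := 0) (b := 1) (by norm_num)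
    (by norm_num [g])
  obtain ⟨b, ⟨hb0, hb1⟩, hb⟩ := exists_root_mem_Ioo hg (a := 2) (b := 3) (by norm_num)
    (by norm_num [g])
  obtain ⟨c, ⟨hc0, hc1⟩, hc⟩ := exists_root_mem_Ioo hg (a := 5) (b := 6) (by norm_num)
    (by norm_num [g])
  obtain ⟨d, ⟨hd0, hd1⟩, hd⟩ := exists_root_mem_Ioo hg (a := 50) (b := 51) (by norm_num)
    (by norm_num [g])
  let y : Fin 6 → ℝ := ![1, 11, a, b, c, d]
  have hroot : ∀ j : Fin 6, 2 ≤ (j : ℕ) → g (y j) = 0 := by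
    intro j hj
    fin_cases j
    · simp at hj
    · simp at hj
    · exact ha
    · exact hb
    · exact hc
    · exact hd
  have hinj : Function.Injective y := by
    intro i j hij
    fin_cases i <;> fin_cases j <;> first | rfl | (exfalso; simp [y] at hij <;> linarith)
  -- The coefficients of `x ^ 6 - (x - 1) * (x - 11) * g x`.
  let r : Fin 6 → ℝ := ![-2423784 / 1601, 18888576 / 1601, -26234592 / 1601, 11577776 / 1601,
    -1921411 / 1601, 115036 / 1601]
  have hr : ∀ x, x ^ 6 = ∑ k, r k * x ^ (k : ℕ) + (x - 1) * (x - 11) * g x := by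
    intro x
    simp [r, g, Fin.sum_univ_six]
    ring
  have hyr : ∀ j, y j ^ 6 = ∑ k, r k * y j ^ (k : ℕ) := by
    intro j
    rw [hr (y j), add_eq_left]
    by_cases hj : 2 ≤ (j : ℕ)
    · rw [hroot j hj, mul_zero]
    · have : j = 0 ∨ j = 1 := by omega
      rcases this with rfl | rfl <;> simp [y]
  have hγr : ∀ m, m + 6 ≤ 2 * 6 - 2 → γ (m + 6) = ∑ k, r k * γ (m + k) := by
    intro m hm
    have hm : m ≤ 4 := by omega
    rw [Fin.sum_univ_six]
    interval_cases m <;> simp [r, hγ, hγ10, Nat.factorial] <;> norm_num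
  obtain ⟨ρ, hρ, hmom⟩ := exists_pos_weights_of_recursion hinj hyr hγr hpos
  exact ⟨ρ, y, hρ, hinj, rfl, rfl, fun i hi => hmom i (by omega), hroot⟩
end
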